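/- Let dS, dE ≥ 1, let μ be the uniform probability measure on the unit sphere of ℂ^{dS·dE} (vectors indexed by Fin dS × Fin dE), and let ε > 0. For a unit vector ψ, let ρ_S^ψ be its reduced density matrix, ρ_S^ψ(s,s′) = Σ_{e} ψ(s,e)·conj(ψ(s′,e)). Then μ { ψ : ‖ρ_S^ψ − (1/dS) • 1‖_F ≥ ε } ≤ (dS² − 1)/(ε² · dS · (dS·dE + 1)). (Canonical typicality as local indistinguishability: when dE is much larger than dS, almost every pure state of the universe has a reduced state on the subsystem that is close to the reduced state of the impure universal state W_R, so local data cannot distinguish whether the universal quantum state is pure or mixed.) -/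

import Mathlib

open Matrix MeasureTheory

noncomputable instance {ι : Type*} : MeasurableSpace (EuclideanSpace ℂ ι) := borel _

instance {ι : Type*} : BorelSpace (EuclideanSpace ℂ ι) := ⟨rfl⟩

/-- The reduced density matrix of the pure state `|ψ⟩⟨ψ|`: the partial trace over the
environment, `ρ_S^ψ(s,s′) = Σ_e ψ(s,e)·conj(ψ(s′,e))`. -/
noncomputable def reducedState {dS dE : ℕ}
    (ψ : EuclideanSpace ℂ (Fin dS × Fin dE)) : Matrix (Fin dS) (Fin dS) ℂ :=
  Matrix.of fun s s' => ∑ e : Fin dE, ψ (s, e) * star (ψ (s', e))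

/-- The Frobenius (Hilbert–Schmidt) norm `‖A‖_F = sqrt (Σ_{s,s′} |A(s,s′)|²)`. -/
noncomputable def frobNorm {dS : ℕ} (A : Matrix (Fin dS) (Fin dS) ℂ) : ℝ :=
  Real.sqrt (∑ s : Fin dS, ∑ s' : Fin dS, Complex.normSq (A s s'))

/-- `μ` is the uniform probability measure on the unit sphere of `ℂ^ι`: a Borel
probability measure invariant under every unitary rotation of `ℂ^ι`. (The normalized
rotation-invariant surface measure is the unique such measure.) -/
def IsUniformSphereMeasure {ι : Type*} [Fintype ι] [DecidableEq ι]
    (μ : Measure (Metric.sphere (0 : EuclideanSpace ℂ ι) 1)) : Prop :=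
  IsProbabilityMeasure μ ∧
    ∀ U : Matrix ι ι ℂ, U ∈ Matrix.unitaryGroup ι ℂ →
      Measure.map
        (fun ψ : EuclideanSpace ℂ ι =>
          (WithLp.equiv 2 (ι → ℂ)).symm (U.mulVec ((WithLp.equiv 2 (ι → ℂ)) ψ)))
        (Measure.map Subtype.val μ) = Measure.map Subtype.val μ

section Aux

variable {ι : Type*} [Fintype ι] [DecidableEq ι]

lemma aux_integrable (μ : Measure (Metric.sphere (0 : EuclideanSpace ℂ ι) 1))
    [IsProbabilityMeasure μ] (f : EuclideanSpace ℂ ι → ℝ) (hf : Continuous f) :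
    Integrable (fun ψ : Metric.sphere (0 : EuclideanSpace ℂ ι) 1 => f ψ) μ := by
  have hc : Continuous (fun ψ : Metric.sphere (0 : EuclideanSpace ℂ ι) 1 => f ψ) :=
    hf.comp continuous_subtype_val
  haveI : CompactSpace (Metric.sphere (0 : EuclideanSpace ℂ ι) 1) :=
    isCompact_iff_compactSpace.mp (isCompact_sphere _ _)
  exact hc.integrable_of_hasCompactSupport (HasCompactSupport.of_compactSpace _)

lemma aux_invariant (μ : Measure (Metric.sphere (0 : EuclideanSpace ℂ ι) 1))
    (hμ : IsUniformSphereMeasure μ) (U : Matrix ι ι ℂ) (hU : U ∈ Matrix.unitaryGroup ι ℂ)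
    (f : EuclideanSpace ℂ ι → ℝ) (hf : Continuous f) :
    ∫ ψ, f (WithLp.toLp 2 (U.mulVec (WithLp.ofLp (ψ : EuclideanSpace ℂ ι)))) ∂μ
      = ∫ ψ, f (ψ : EuclideanSpace ℂ ι) ∂μ := by
  have h := hμ.2 U hU
  have hT : Continuous (fun ψ : EuclideanSpace ℂ ι =>
      (WithLp.equiv 2 (ι → ℂ)).symm (U.mulVec ((WithLp.equiv 2 (ι → ℂ)) ψ))) := by
    change Continuous (fun ψ : EuclideanSpace ℂ ι =>
      WithLp.toLp 2 (U.mulVec (WithLp.ofLp ψ)))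
    refine (PiLp.continuous_toLp 2 _).comp ?_
    exact Continuous.matrix_mulVec continuous_const (PiLp.continuous_ofLp 2 _)
  have h2 := integral_map (μ := Measure.map Subtype.val μ) (f := f) hT.measurable.aemeasurable
    hf.measurable.aestronglyMeasurable
  have h3 := integral_map (μ := μ) measurable_subtype_coe.aemeasurable
      (hf.comp hT).measurable.aestronglyMeasurable
  rw [h, integral_map measurable_subtype_coe.aemeasurable
    hf.measurable.aestronglyMeasurable] at h2
  exact (h2.trans h3).symm

lemma aux_int_sum {α : Type*} [Fintype α]
    (μ : Measure (Metric.sphere (0 : EuclideanSpace ℂ ι) 1)) [IsProbabilityMeasure μ]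
    (F : α → EuclideanSpace ℂ ι → ℝ) (hF : ∀ a, Continuous (F a)) :
    ∫ ψ, ∑ a, F a (ψ : EuclideanSpace ℂ ι) ∂μ = ∑ a, ∫ ψ, F a (ψ : EuclideanSpace ℂ ι) ∂μ :=
  integral_finsetSum _ (fun a _ => aux_integrable μ (F a) (hF a))

/-- Diagonal phase at one coordinate. -/
lemma aux_phase (i : ι) (c : ℂ) (hc : c * star c = 1) :
    Matrix.diagonal (Function.update (1 : ι → ℂ) i c) ∈ Matrix.unitaryGroup ι ℂ := by
  rw [Matrix.mem_unitaryGroup_iff, Matrix.star_eq_conjTranspose, Matrix.diagonal_conjTranspose,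
    Matrix.diagonal_mul_diagonal, ← Matrix.diagonal_one]
  congr 1
  funext k
  by_cases hk : k = i
  · subst hk; simpa using hc
  · simp [hk]

lemma aux_phase_apply (i : ι) (c : ℂ) (v : ι → ℂ) (k : ι) :
    (Matrix.diagonal (Function.update (1 : ι → ℂ) i c)).mulVec v k
      = if k = i then c * v k else v k := by
  rw [Matrix.mulVec_diagonal]
  by_cases hk : k = i
  · subst hk; simp
  · simp [hk]

/-- Two-coordinate mixing unitary. -/
noncomputable def auxW (i j : ι) : ι → ℂ := Pi.single i 1 + Pi.single j 1

noncomputable def auxMix (i j : ι) : Matrix ι ι ℂ :=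
  1 + ((Complex.I - 1) / 2) • Matrix.vecMulVec (auxW i j) (auxW i j)

lemma auxW_dot (i j : ι) (v : ι → ℂ) : auxW i j ⬝ᵥ v = v i + v j := by
  simp [auxW, add_dotProduct]

lemma auxW_star (i j : ι) : star (auxW i j) = auxW i j := by
  funext k
  simp only [auxW, Pi.star_apply, Pi.add_apply, Pi.single_apply, star_add]
  split_ifs <;> simp

lemma auxMix_mem (i j : ι) (hij : i ≠ j) : auxMix i j ∈ Matrix.unitaryGroup ι ℂ := by
  rw [Matrix.mem_unitaryGroup_iff, Matrix.star_eq_conjTranspose]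
  have hww : auxW i j ⬝ᵥ auxW i j = 2 := by
    rw [auxW_dot]
    simp [auxW, hij, hij.symm]
    norm_num
  have hP : Matrix.vecMulVec (auxW i j) (auxW i j) * Matrix.vecMulVec (auxW i j) (auxW i j)
      = (2 : ℂ) • Matrix.vecMulVec (auxW i j) (auxW i j) := by
    rw [Matrix.vecMulVec_mul_vecMulVec, hww]
    ext a b
    simp [Matrix.vecMulVec_apply]
    ring
  have hH : (Matrix.vecMulVec (auxW i j) (auxW i j))ᴴ = Matrix.vecMulVec (auxW i j) (auxW i j) := by
    rw [Matrix.conjTranspose_vecMulVec, auxW_star]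
  rw [auxMix, Matrix.conjTranspose_add, Matrix.conjTranspose_smul, hH, Matrix.conjTranspose_one]
  rw [mul_add, add_mul, add_mul, mul_one, one_mul, mul_one, smul_mul_smul_comm, hP, smul_smul]
  rw [add_assoc, ← add_smul, ← add_smul]
  have : (Complex.I - 1) / 2 + (star ((Complex.I - 1) / 2) + (Complex.I - 1) / 2 *
      star ((Complex.I - 1) / 2) * 2) = 0 := by
    apply Complex.ext <;> simp <;> norm_num
  rw [this]
  simp

lemma auxMix_apply (i j : ι) (v : ι → ℂ) (k : ι) :
    (auxMix i j).mulVec v k = v k + (Complex.I - 1) / 2 * ((v i + v j) * auxW i j k) := by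
  rw [auxMix, Matrix.add_mulVec, Matrix.one_mulVec, Matrix.smul_mulVec,
    Matrix.vecMulVec_mulVec, auxW_dot]
  simp
  left
  ring

noncomputable def auxM (μ : Measure (Metric.sphere (0 : EuclideanSpace ℂ ι) 1)) (i j : ι) : ℝ :=
  ∫ ψ, Complex.normSq ((ψ : EuclideanSpace ℂ ι) i) *
    Complex.normSq ((ψ : EuclideanSpace ℂ ι) j) ∂μ

lemma aux_coord (i : ι) : Continuous (fun ψ : EuclideanSpace ℂ ι => ψ i) :=
  PiLp.continuous_apply 2 _ i

lemma aux_nsq (i : ι) : Continuous (fun ψ : EuclideanSpace ℂ ι => Complex.normSq (ψ i)) :=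
  Complex.continuous_normSq.comp (aux_coord i)

lemma auxM_eq (μ : Measure (Metric.sphere (0 : EuclideanSpace ℂ ι) 1))
    (hμ : IsUniformSphereMeasure μ) (i j : ι) :
    auxM μ i j = (1 + if i = j then 1 else 0) * ((auxM μ i i + auxM μ j j) / 4) := by
  by_cases hij : i = j
  · subst hij; simp; ring
  haveI := hμ.1
  let g : EuclideanSpace ℂ ι → ℝ := fun ψ => (ψ i * ψ i * star (ψ j * ψ j)).re
  have hg : Continuous g := Complex.continuous_re.comp
    (((aux_coord i).mul (aux_coord i)).mul ((aux_coord j).mul (aux_coord j)).star)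
  have hg0 : ∫ ψ, g (ψ : EuclideanSpace ℂ ι) ∂μ = 0 := by
    have h := aux_invariant μ hμ _ (aux_phase j Complex.I (by simp)) g hg
    have h2 : ∀ ψ : Metric.sphere (0 : EuclideanSpace ℂ ι) 1,
        g (WithLp.toLp 2 ((Matrix.diagonal (Function.update (1 : ι → ℂ) j Complex.I)).mulVec
          (WithLp.ofLp (ψ : EuclideanSpace ℂ ι)))) = - g ψ := by
      intro ψ
      simp only [g, aux_phase_apply, if_neg hij, if_true]
      simp
      ring
    simp_rw [h2] at h
    rw [integral_neg] at h
    linarith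
  let f : EuclideanSpace ℂ ι → ℝ := fun ψ => Complex.normSq (ψ i) * Complex.normSq (ψ j)
  have hf : Continuous f := (aux_nsq i).mul (aux_nsq j)
  have h := aux_invariant μ hμ _ (auxMix_mem i j hij) f hf
  have h2 : ∀ ψ : Metric.sphere (0 : EuclideanSpace ℂ ι) 1,
      f (WithLp.toLp 2 ((auxMix i j).mulVec (WithLp.ofLp (ψ : EuclideanSpace ℂ ι))))
       = (1 / 4) * (Complex.normSq ((ψ : EuclideanSpace ℂ ι) i) *
          Complex.normSq ((ψ : EuclideanSpace ℂ ι) i)) +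
         (1 / 4) * (Complex.normSq ((ψ : EuclideanSpace ℂ ι) j) *
          Complex.normSq ((ψ : EuclideanSpace ℂ ι) j)) + (1 / 2) * g ψ := by
    intro ψ
    simp only [f, g, auxMix_apply]
    have h1 : auxW i j i = 1 := by simp [auxW, hij]
    have h3 : auxW i j j = 1 := by simp [auxW, Ne.symm hij]
    rw [h1, h3]
    generalize (ψ : EuclideanSpace ℂ ι) i = a
    generalize (ψ : EuclideanSpace ℂ ι) j = b
    have e1 : a + (Complex.I - 1) / 2 * ((a + b) * 1) =
        (⟨(a.re - a.im - b.re - b.im) / 2, (a.re + a.im + b.re - b.im) / 2⟩ : ℂ) := by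
      apply Complex.ext <;> simp <;> ring
    have e2 : b + (Complex.I - 1) / 2 * ((a + b) * 1) =
        (⟨(b.re - b.im - a.re - a.im) / 2, (b.re + b.im + a.re - a.im) / 2⟩ : ℂ) := by
      apply Complex.ext <;> simp <;> ring
    rw [e1, e2]
    simp [Complex.normSq_apply]
    ring
  simp_rw [h2] at h
  rw [integral_add, integral_add, integral_const_mul, integral_const_mul, integral_const_mul,
    hg0] at h
  · simp only [auxM, hij, if_false]
    simp only [f] at h
    linarith
  · exact (aux_integrable μ _ ((aux_nsq i).mul (aux_nsq i))).const_mul _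
  · exact (aux_integrable μ _ ((aux_nsq j).mul (aux_nsq j))).const_mul _
  · exact ((aux_integrable μ _ ((aux_nsq i).mul (aux_nsq i))).const_mul _).add
      ((aux_integrable μ _ ((aux_nsq j).mul (aux_nsq j))).const_mul _)
  · exact (aux_integrable μ _ hg).const_mul _

lemma aux_norm (ψ : Metric.sphere (0 : EuclideanSpace ℂ ι) 1) :
    ∑ i, Complex.normSq ((ψ : EuclideanSpace ℂ ι) i) = 1 := by
  have h : ‖(ψ : EuclideanSpace ℂ ι)‖ = 1 := by simpa using ψ.2
  have h2 := EuclideanSpace.norm_sq_eq (ψ : EuclideanSpace ℂ ι)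
  rw [h] at h2
  simp_rw [Complex.normSq_eq_norm_sq]
  linarith

lemma auxM_sum (μ : Measure (Metric.sphere (0 : EuclideanSpace ℂ ι) 1))
    (hμ : IsUniformSphereMeasure μ) :
    ((Fintype.card ι : ℝ) + 1) * ∑ i, auxM μ i i = 2 := by
  haveI := hμ.1
  have h1 : ∑ i, ∑ j, auxM μ i j = 1 := by
    simp only [auxM]
    have : ∀ i, ∑ j, ∫ ψ, Complex.normSq ((ψ : EuclideanSpace ℂ ι) i) *
        Complex.normSq ((ψ : EuclideanSpace ℂ ι) j) ∂μ =
        ∫ ψ, Complex.normSq ((ψ : EuclideanSpace ℂ ι) i) ∂μ := by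
      intro i
      rw [← aux_int_sum μ (fun j (ψ : EuclideanSpace ℂ ι) =>
        Complex.normSq (ψ i) * Complex.normSq (ψ j)) (fun j => (aux_nsq i).mul (aux_nsq j))]
      refine integral_congr_ae (Filter.Eventually.of_forall fun ψ => ?_)
      simp only
      rw [← Finset.mul_sum, aux_norm, mul_one]
    rw [Finset.sum_congr rfl (fun i _ => this i),
      ← aux_int_sum μ (fun i (ψ : EuclideanSpace ℂ ι) => Complex.normSq (ψ i)) aux_nsq]
    simp_rw [aux_norm]
    simp
  have h2 : ∑ i, ∑ j, auxM μ i j =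
      ((Fintype.card ι : ℝ) + 1) * (∑ i, auxM μ i i) / 2 := by
    rw [Finset.sum_congr rfl (fun i _ => Finset.sum_congr rfl (fun j _ => auxM_eq μ hμ i j))]
    simp only [add_mul, one_mul, ite_mul, zero_mul, Finset.sum_add_distrib, Finset.sum_ite_eq,
      Finset.mem_univ, if_true, ← Finset.sum_div, Finset.sum_const, Finset.card_univ,
      nsmul_eq_mul, ← Finset.mul_sum]
    ring
  linarith

end Aux

section Main

variable {dS dE : ℕ}

/-- Quartic term. -/
noncomputable def auxT (s s' : Fin dS) (e e' : Fin dE)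
    (ψ : EuclideanSpace ℂ (Fin dS × Fin dE)) : ℝ :=
  (ψ (s, e) * star (ψ (s', e)) * star (ψ (s, e') * star (ψ (s', e')))).re

lemma auxT_cont (s s' : Fin dS) (e e' : Fin dE) : Continuous (auxT s s' e e') :=
  Complex.continuous_re.comp (((aux_coord _).mul (aux_coord _).star).mul
    ((aux_coord _).mul (aux_coord _).star).star)

lemma auxT_integral (μ : Measure (Metric.sphere (0 : EuclideanSpace ℂ (Fin dS × Fin dE)) 1))
    (hμ : IsUniformSphereMeasure μ) (s s' : Fin dS) (e e' : Fin dE) :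
    ∫ ψ, auxT s s' e e' (ψ : EuclideanSpace ℂ (Fin dS × Fin dE)) ∂μ =
      ((if s = s' then 1 else 0) + (if e = e' then 1 else 0)) *
        ((auxM μ (s, e) (s, e) + auxM μ (s', e') (s', e')) / 4) := by
  by_cases hs : s = s'
  · subst hs
    have : ∫ ψ, auxT s s e e' (ψ : EuclideanSpace ℂ (Fin dS × Fin dE)) ∂μ
        = auxM μ (s, e) (s, e') := by
      refine integral_congr_ae (Filter.Eventually.of_forall fun ψ => ?_)
      simp only [auxT, Complex.normSq_apply, star_mul, star_star, Complex.star_def,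
        Complex.mul_re, Complex.mul_im, Complex.conj_re, Complex.conj_im]
      ring
    rw [this, auxM_eq μ hμ]
    simp
  by_cases he : e = e'
  · subst he
    have : ∫ ψ, auxT s s' e e (ψ : EuclideanSpace ℂ (Fin dS × Fin dE)) ∂μ
        = auxM μ (s, e) (s', e) := by
      refine integral_congr_ae (Filter.Eventually.of_forall fun ψ => ?_)
      simp only [auxT, Complex.normSq_apply, star_mul, star_star, Complex.star_def,
        Complex.mul_re, Complex.mul_im, Complex.conj_re, Complex.conj_im]
      ring
    rw [this, auxM_eq μ hμ]
    simp [hs]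
  have h := aux_invariant μ hμ _ (aux_phase (s, e) (-1) (by simp)) _ (auxT_cont s s' e e')
  have h2 : ∀ ψ : Metric.sphere (0 : EuclideanSpace ℂ (Fin dS × Fin dE)) 1,
      auxT s s' e e' (WithLp.toLp 2 ((Matrix.diagonal
        (Function.update (1 : (Fin dS × Fin dE) → ℂ) (s, e) (-1))).mulVec
          (WithLp.ofLp (ψ : EuclideanSpace ℂ (Fin dS × Fin dE))))) = - auxT s s' e e' ψ := by
    intro ψ
    have e1 : (s', e) ≠ (s, e) := fun h => hs (by simpa using (congrArg Prod.fst h).symm)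
    have e2 : (s, e') ≠ (s, e) := fun h => he (by simpa using (congrArg Prod.snd h).symm)
    have e3 : (s', e') ≠ (s, e) := fun h => hs (by simpa using (congrArg Prod.fst h).symm)
    simp only [auxT, aux_phase_apply, if_neg e1, if_neg e2, if_neg e3, if_true]
    rw [← Complex.neg_re]
    congr 1
    ring
  simp_rw [h2] at h
  rw [integral_neg] at h
  simp only [hs, he, if_false]
  linarith

lemma aux_frob (hdS : 1 ≤ dS) (ψ : Metric.sphere (0 : EuclideanSpace ℂ (Fin dS × Fin dE)) 1) :
    frobNorm (reducedState (ψ : EuclideanSpace ℂ (Fin dS × Fin dE)) -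
          ((dS : ℂ))⁻¹ • (1 : Matrix (Fin dS) (Fin dS) ℂ)) ^ 2 =
      (∑ s, ∑ s', ∑ e, ∑ e', auxT s s' e e' (ψ : EuclideanSpace ℂ (Fin dS × Fin dE)))
        - (dS : ℝ)⁻¹ := by
  have hd : (dS : ℝ) ≠ 0 := by positivity
  have hfr : ∀ A : Matrix (Fin dS) (Fin dS) ℂ,
      frobNorm A ^ 2 = ∑ s, ∑ s', Complex.normSq (A s s') := fun A =>
    Real.sq_sqrt (Finset.sum_nonneg fun s _ => Finset.sum_nonneg fun s' _ =>
      Complex.normSq_nonneg (A s s'))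
  rw [hfr]
  have key : ∀ s s' : Fin dS, Complex.normSq ((reducedState
      (ψ : EuclideanSpace ℂ (Fin dS × Fin dE)) -
          ((dS : ℂ))⁻¹ • (1 : Matrix (Fin dS) (Fin dS) ℂ)) s s') =
      (∑ e, ∑ e', auxT s s' e e' (ψ : EuclideanSpace ℂ (Fin dS × Fin dE))) +
        if s = s' then (dS : ℝ)⁻¹ ^ 2 - 2 * (dS : ℝ)⁻¹ *
          ∑ e, Complex.normSq ((ψ : EuclideanSpace ℂ (Fin dS × Fin dE)) (s, e)) else 0 := by
    intro s s'
    have h1 : ∑ e, ∑ e', auxT s s' e e' (ψ : EuclideanSpace ℂ (Fin dS × Fin dE)) =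
        Complex.normSq (reducedState (ψ : EuclideanSpace ℂ (Fin dS × Fin dE)) s s') := by
      have : ((Complex.normSq (reducedState (ψ : EuclideanSpace ℂ (Fin dS × Fin dE)) s s') : ℝ) : ℂ)
        = ∑ e, ∑ e', (ψ : EuclideanSpace ℂ (Fin dS × Fin dE)) (s, e) *
          star ((ψ : EuclideanSpace ℂ (Fin dS × Fin dE)) (s', e)) *
          star ((ψ : EuclideanSpace ℂ (Fin dS × Fin dE)) (s, e') *
            star ((ψ : EuclideanSpace ℂ (Fin dS × Fin dE)) (s', e'))) := by
        rw [← Complex.mul_conj, reducedState, Matrix.of_apply, map_sum, Finset.sum_mul_sum]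
        rfl
      have h := congrArg Complex.re this
      rw [Complex.ofReal_re] at h
      rw [h]
      simp only [Complex.re_sum]
      rfl
    rw [h1]
    by_cases hs : s = s'
    · subst hs
      have h2 : reducedState (ψ : EuclideanSpace ℂ (Fin dS × Fin dE)) s s =
          ((∑ e, Complex.normSq ((ψ : EuclideanSpace ℂ (Fin dS × Fin dE)) (s, e)) : ℝ) : ℂ) := by
        rw [reducedState, Matrix.of_apply, Complex.ofReal_sum]
        exact Finset.sum_congr rfl fun e _ => Complex.mul_conj _
      simp only [Matrix.sub_apply, Matrix.smul_apply, Matrix.one_apply_eq, h2, if_true, smul_eq_mul,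
        mul_one]
      have h3 : ((dS : ℂ))⁻¹ = (((dS : ℝ)⁻¹ : ℝ) : ℂ) := by push_cast; rfl
      rw [h3, ← Complex.ofReal_sub, Complex.normSq_ofReal, Complex.normSq_ofReal]
      ring
    · simp [Matrix.one_apply_ne hs, hs]
  simp_rw [key]
  have hn := aux_norm ψ
  rw [Fintype.sum_prod_type] at hn
  simp only [Finset.sum_add_distrib, Finset.sum_ite_eq, Finset.mem_univ, if_true,
    Finset.sum_sub_distrib, ← Finset.mul_sum, hn]
  simp
  field_simp
  ring

lemma aux_expect (hdS : 1 ≤ dS)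
    (μ : Measure (Metric.sphere (0 : EuclideanSpace ℂ (Fin dS × Fin dE)) 1))
    (hμ : IsUniformSphereMeasure μ) :
    ∫ ψ, ((∑ s, ∑ s', ∑ e, ∑ e', auxT s s' e e' (ψ : EuclideanSpace ℂ (Fin dS × Fin dE)))
        - (dS : ℝ)⁻¹) ∂μ =
      ((dS : ℝ) ^ 2 - 1) / ((dS : ℝ) * ((dS : ℝ) * (dE : ℝ) + 1)) := by
  haveI := hμ.1
  have hc1 : ∀ s s' e, Continuous (fun ψ : EuclideanSpace ℂ (Fin dS × Fin dE) =>
      ∑ e', auxT s s' e e' ψ) :=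
    fun s s' e => continuous_finsetSum _ fun e' _ => auxT_cont s s' e e'
  have hc2 : ∀ s s', Continuous (fun ψ : EuclideanSpace ℂ (Fin dS × Fin dE) =>
      ∑ e, ∑ e', auxT s s' e e' ψ) :=
    fun s s' => continuous_finsetSum _ fun e _ => hc1 s s' e
  have hc3 : ∀ s, Continuous (fun ψ : EuclideanSpace ℂ (Fin dS × Fin dE) =>
      ∑ s', ∑ e, ∑ e', auxT s s' e e' ψ) :=
    fun s => continuous_finsetSum _ fun s' _ => hc2 s s'
  have hc4 : Continuous (fun ψ : EuclideanSpace ℂ (Fin dS × Fin dE) =>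
      ∑ s, ∑ s', ∑ e, ∑ e', auxT s s' e e' ψ) :=
    continuous_finsetSum _ fun s _ => hc3 s
  have hI : ∫ ψ, (∑ s, ∑ s', ∑ e, ∑ e',
      auxT s s' e e' (ψ : EuclideanSpace ℂ (Fin dS × Fin dE))) ∂μ =
      ∑ s, ∑ s', ∑ e, ∑ e', (((if s = s' then 1 else 0) + (if e = e' then 1 else 0)) *
        ((auxM μ (s, e) (s, e) + auxM μ (s', e') (s', e')) / 4) : ℝ) := by
    refine (aux_int_sum μ _ hc3).trans (Finset.sum_congr rfl fun s _ => ?_)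
    refine (aux_int_sum μ _ (hc2 s)).trans (Finset.sum_congr rfl fun s' _ => ?_)
    refine (aux_int_sum μ _ (hc1 s s')).trans (Finset.sum_congr rfl fun e _ => ?_)
    refine (aux_int_sum μ _ (auxT_cont s s' e)).trans (Finset.sum_congr rfl fun e' _ => ?_)
    exact auxT_integral μ hμ s s' e e'
  rw [integral_sub (aux_integrable μ _ hc4) (integrable_const _), hI]
  have hA := auxM_sum μ hμ
  rw [Fintype.sum_prod_type] at hA
  simp only [Fintype.card_prod, Fintype.card_fin, Nat.cast_mul] at hA
  set A : Fin dS → Fin dE → ℝ := fun s e => auxM μ (s, e) (s, e) with hAdef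
  have hsum : ∑ s, ∑ s', ∑ e, ∑ e', (((if s = s' then 1 else 0) + (if e = e' then 1 else 0)) *
        ((A s e + A s' e') / 4) : ℝ) = (dS + dE) * (∑ s, ∑ e, A s e) / 2 := by
    have h1 : ∑ s, ∑ s', ∑ e, ∑ e', ((if s = s' then 1 else 0) * ((A s e + A s' e') / 4) : ℝ)
        = dE * (∑ s, ∑ e, A s e) / 2 := by
      simp only [← Finset.mul_sum]
      simp only [← Finset.mul_sum, ite_mul, one_mul, zero_mul, Finset.sum_ite_eq, Finset.mem_univ,
        if_true, ← Finset.sum_div, Finset.sum_add_distrib, Finset.sum_const, Finset.card_univ,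
        Fintype.card_fin, nsmul_eq_mul]
      ring
    have h2 : ∑ s, ∑ s', ∑ e, ∑ e', ((if e = e' then 1 else 0) * ((A s e + A s' e') / 4) : ℝ)
        = dS * (∑ s, ∑ e, A s e) / 2 := by
      simp only [← Finset.mul_sum, ite_mul, one_mul, zero_mul, Finset.sum_ite_eq, Finset.mem_univ,
        if_true, ← Finset.sum_div, Finset.sum_add_distrib, Finset.sum_const, Finset.card_univ,
        Fintype.card_fin, nsmul_eq_mul]
      ring
    simp only [add_mul (ite _ _ _), Finset.sum_add_distrib]
    rw [h1, h2]
    ring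
  rw [hsum]
  have hd : (0 : ℝ) < dS := by positivity
  have hn : (0 : ℝ) < (dS : ℝ) * dE + 1 := by positivity
  have hA' : ∑ s, ∑ e, A s e = 2 / ((dS : ℝ) * dE + 1) := by
    rw [eq_div_iff hn.ne', mul_comm]
    exact hA
  rw [hA']
  simp
  field_simp
  ring

end Main

/-- Canonical typicality as local indistinguishability: the measure of
pure universal states whose reduced state is at Frobenius distance at least `ε` from the
reduced state `(1/dS) • 1` of `W_R` is at most `(dS² − 1)/(ε²·dS·(dS·dE + 1))`. -/
theorem canonical_typicality_chebyshev_bound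
    (dS dE : ℕ) (hdS : 1 ≤ dS) (hdE : 1 ≤ dE)
    (μ : Measure (Metric.sphere (0 : EuclideanSpace ℂ (Fin dS × Fin dE)) 1))
    (hμ : IsUniformSphereMeasure μ) (ε : ℝ) (hε : 0 < ε) :
    μ {ψ : Metric.sphere (0 : EuclideanSpace ℂ (Fin dS × Fin dE)) 1 |
        ε ≤ frobNorm (reducedState (ψ : EuclideanSpace ℂ (Fin dS × Fin dE)) -
          ((dS : ℂ))⁻¹ • (1 : Matrix (Fin dS) (Fin dS) ℂ))} ≤
      ENNReal.ofReal
        (((dS : ℝ) ^ 2 - 1) / (ε ^ 2 * (dS : ℝ) * ((dS : ℝ) * (dE : ℝ) + 1))) := by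
  haveI := hμ.1
  have hc : Continuous (fun ψ : EuclideanSpace ℂ (Fin dS × Fin dE) =>
      (∑ s, ∑ s', ∑ e, ∑ e', auxT s s' e e' ψ) - (dS : ℝ)⁻¹) := by
    refine Continuous.sub ?_ continuous_const
    exact continuous_finsetSum _ fun s _ => continuous_finsetSum _ fun s' _ =>
      continuous_finsetSum _ fun e _ => continuous_finsetSum _ fun e' _ => auxT_cont s s' e e'
  have hint := aux_integrable μ _ hc
  have hcheb := mul_meas_ge_le_integral_of_nonneg (μ := μ)
    (Filter.Eventually.of_forall fun ψ => by
      rw [Pi.zero_apply, ← aux_frob hdS ψ]; positivity) hint (ε ^ 2)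
  rw [aux_expect hdS μ hμ] at hcheb
  have hset : {ψ : Metric.sphere (0 : EuclideanSpace ℂ (Fin dS × Fin dE)) 1 |
        ε ≤ frobNorm (reducedState (ψ : EuclideanSpace ℂ (Fin dS × Fin dE)) -
          ((dS : ℂ))⁻¹ • (1 : Matrix (Fin dS) (Fin dS) ℂ))} ⊆
      {ψ | ε ^ 2 ≤ (∑ s, ∑ s', ∑ e, ∑ e',
        auxT s s' e e' (ψ : EuclideanSpace ℂ (Fin dS × Fin dE))) - (dS : ℝ)⁻¹} := by
    intro ψ hψ
    simp only [Set.mem_setOf_eq] at hψ ⊢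
    rw [← aux_frob hdS ψ]
    gcongr
  refine (measure_mono hset).trans ?_
  rw [← ENNReal.ofReal_toReal (measure_ne_top μ _)]
  apply ENNReal.ofReal_le_ofReal
  have : ((dS : ℝ) ^ 2 - 1) / (ε ^ 2 * (dS : ℝ) * ((dS : ℝ) * (dE : ℝ) + 1)) =
      ((dS : ℝ) ^ 2 - 1) / ((dS : ℝ) * ((dS : ℝ) * (dE : ℝ) + 1)) / ε ^ 2 := by
    rw [div_div]; congr 1; ring
  rw [this, le_div_iff₀ (by positivity), mul_comm]
  exact hcheb
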